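/- Let $A$ be a finite-dimensional associative unital soluble $K$-algebra with separable radical factor algebra. Then a subalgebra $T$ of $A$ is a maximal torus of $A$ if and only if $T$ is a radical complement of $A$. -/

import Mathlib

open scoped TensorProduct

universe u

/-- An element `a` of an associative unital `K`-algebra `A` is *separable over `K`* if it is
algebraic over `K` and its minimal polynomial over `K` is separable, i.e. a product of pairwise
distinct irreducible separable polynomials of `K[t]`. -/
def IsSeparableElement (K : Type u) {A : Type u} [Field K] [Ring A] [Algebra K A] (a : A) : Prop :=
  IsIntegral K a ∧ (minpoly K a).Separable

/-- A *torus* of an associative unital `K`-algebra `A` is a commutative unital `K`-subalgebra of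
`A` all of whose elements are separable over `K`. -/
def IsTorus (K : Type u) {A : Type u} [Field K] [Ring A] [Algebra K A]
    (T : Subalgebra K A) : Prop :=
  (∀ a ∈ T, ∀ b ∈ T, a * b = b * a) ∧ ∀ a ∈ T, IsSeparableElement K a

/-- A *maximal torus* of `A` is a torus which is not properly contained in any other torus. -/
def IsMaximalTorus (K : Type u) {A : Type u} [Field K] [Ring A] [Algebra K A]
    (T : Subalgebra K A) : Prop :=
  IsTorus K T ∧ ∀ S : Subalgebra K A, IsTorus K S → T ≤ S → T = S

/-- The Jacobson radical of the ring `A`, i.e. the intersection of all maximal left ideals of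
`A`; for a finite-dimensional algebra it coincides with the nilradical. -/
def jacobsonRadical (A : Type u) [Ring A] : Ideal A :=
  Ideal.jacobson ⊥

/-- A *radical complement* of `A` is a unital `K`-subalgebra `C` of `A` such that
`A = C ⊕ rad A` as `K`-vector spaces. -/
def IsRadicalComplement (K : Type u) {A : Type u} [Field K] [Ring A] [Algebra K A]
    (C : Subalgebra K A) : Prop :=
  IsCompl (Subalgebra.toSubmodule C) ((jacobsonRadical A).restrictScalars K)

/-- `A` is a *soluble* algebra if `A / rad A` is commutative, i.e. every commutator of `A` lies
in the Jacobson radical of `A`. -/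
def IsSolubleAlgebra (A : Type u) [Ring A] : Prop :=
  ∀ a b : A, a * b - b * a ∈ jacobsonRadical A

/-- `A` has a *separable radical factor algebra* if the quotient algebra `A / rad A`
(presented as the image `B` of a surjective algebra homomorphism with kernel `rad A`) becomes a
semisimple ring after every base change to a field extension `F` of `K`. -/
def HasSeparableRadicalFactor (K : Type u) (A : Type u) [Field K] [Ring A] [Algebra K A] : Prop :=
  ∃ (B : Type u) (_ : Ring B) (_ : Algebra K B) (φ : A →ₐ[K] B),
    Function.Surjective φ ∧ (∀ x : A, φ x = 0 ↔ x ∈ jacobsonRadical A) ∧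
      ∀ (F : Type u) (_ : Field F) (_ : Algebra K F), IsSemisimpleRing (F ⊗[K] B)

open Polynomial in
/-- An integral element of a geometrically reduced algebra is separable. -/
theorem isSeparableElement_of_isReduced_tensorProduct {K B : Type u} [Field K] [CommRing B]
    [Algebra K B] [IsReduced (AlgebraicClosure K ⊗[K] B)] {b : B} (hb : IsIntegral K b) :
    IsSeparableElement K b := by
  refine ⟨hb, ?_⟩
  rw [← separable_map (algebraMap K (AlgebraicClosure K)), PerfectField.separable_iff_squarefree]
  set q := (minpoly K b).map (algebraMap K (AlgebraicClosure K)) with hq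
  let β : AlgebraicClosure K ⊗[K] B := 1 ⊗ₜ b
  have hβ : aeval β q = 0 := by
    have : aeval β (minpoly K b) = 0 := by
      have := aeval_algHom_apply
        (Algebra.TensorProduct.includeRight : B →ₐ[K] AlgebraicClosure K ⊗[K] B) b (minpoly K b)
      simpa [β] using this
    rwa [hq, aeval_map_algebraMap]
  have hli := Module.Flat.linearIndependent_one_tmul (S := AlgebraicClosure K)
    (linearIndependent_pow (K := K) b)
  rintro x ⟨c, hc⟩
  have hq0 : q ≠ 0 := map_monic_ne_zero (minpoly.monic hb)
  have hx0 : x ≠ 0 := by rintro rfl; simp [hc] at hq0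
  have hr0 : x * c ≠ 0 := by intro h; rw [mul_assoc, h, mul_zero] at hc; exact hq0 hc
  have hr : aeval β (x * c) = 0 := by
    refine IsReduced.eq_zero _ ⟨2, ?_⟩
    rw [← map_pow, show (x * c) ^ 2 = q * c by rw [hc]; ring, map_mul, hβ, zero_mul]
  by_contra hx
  have hdeg : (x * c).natDegree < (minpoly K b).natDegree := by
    have h1 : q.natDegree = x.natDegree + (x * c).natDegree := by
      rw [hc, mul_assoc, natDegree_mul hx0 hr0]
    rw [hq, natDegree_map] at h1
    have := natDegree_pos_iff_degree_pos.2 (degree_pos_of_ne_zero_of_nonunit hx0 hx)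
    omega
  rw [aeval_eq_sum_range' hdeg, Finset.sum_range] at hr
  have hcoeff := Fintype.linearIndependent_iff.1 hli (fun i => (x * c).coeff i) (by
    simpa [β, Algebra.TensorProduct.tmul_pow] using hr)
  refine hr0 (leadingCoeff_eq_zero.1 ?_)
  exact hcoeff ⟨_, hdeg⟩

/-- A commutative algebra generated by separable elements is formally unramified. -/
theorem formallyUnramified_of_adjoin_eq_top {K S : Type u} [Field K] [CommRing S] [Algebra K S]
    {X : Set S} (hX : Algebra.adjoin K X = ⊤) (h : ∀ x ∈ X, IsSeparableElement K x) :
    Algebra.FormallyUnramified K S := by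
  rw [Algebra.formallyUnramified_iff]
  have hD : ∀ s : S, KaehlerDifferential.D K S s = 0 := by
    intro s
    have hs : s ∈ Algebra.adjoin K X := hX ▸ Algebra.mem_top
    refine Derivation.eqOn_adjoin (D1 := KaehlerDifferential.D K S) (D2 := 0) (fun x hx => ?_) hs
    have h1 := Derivation.map_aeval (KaehlerDifferential.D K S) (minpoly K x) (x := x)
    rw [minpoly.aeval, map_zero] at h1
    obtain ⟨u, v, huv⟩ := (h x hx).2
    have h2 := congrArg (Polynomial.aeval x) huv
    simp only [map_add, map_mul, minpoly.aeval, mul_zero, zero_add, map_one] at h2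
    rw [Derivation.zero_apply, ← one_smul S (KaehlerDifferential.D K S x), ← h2, mul_smul, ← h1,
      smul_zero]
  refine (Submodule.subsingleton_iff S).1 (subsingleton_of_bot_eq_top ?_)
  rw [← KaehlerDifferential.span_range_derivation, eq_comm, Submodule.span_eq_bot]
  rintro _ ⟨s, rfl⟩
  exact hD s

theorem isSeparableElement_of_formallyUnramified {K S : Type u} [Field K] [CommRing S]
    [Algebra K S] [FiniteDimensional K S] [Algebra.FormallyUnramified K S] (s : S) :
    IsSeparableElement K s := by
  have := Algebra.FormallyUnramified.isReduced_of_field (AlgebraicClosure K)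
    (AlgebraicClosure K ⊗[K] S)
  exact isSeparableElement_of_isReduced_tensorProduct (Algebra.IsIntegral.isIntegral s)

theorem isSeparableElement_map_iff {K A B : Type u} [Field K] [Ring A] [Algebra K A] [Ring B]
    [Algebra K B] (f : A →ₐ[K] B) (hf : Function.Injective f) (a : A) :
    IsSeparableElement K (f a) ↔ IsSeparableElement K a := by
  rw [IsSeparableElement, IsSeparableElement, isIntegral_algHom_iff f hf,
    minpoly.algHom_eq f hf]

theorem IsSeparableElement.eq_zero_of_isNilpotent {K A : Type u} [Field K] [Ring A] [Algebra K A]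
    {a : A} (ha : IsSeparableElement K a) (hn : IsNilpotent a) : a = 0 := by
  obtain ⟨n, hn⟩ := hn
  have h1 : minpoly K a ∣ Polynomial.X ^ n := minpoly.dvd K a (by simp [hn])
  have h2 := minpoly.aeval K a
  obtain ⟨q, hq⟩ := (ha.2.squarefree.isRadical) n _ h1
  simpa [h2] using congrArg (Polynomial.aeval a) hq

/-- The subalgebra generated by commuting separable elements is a torus. -/
theorem isTorus_adjoin {K A : Type u} [Field K] [Ring A] [Algebra K A] [FiniteDimensional K A]
    {X : Set A} (hcomm : ∀ a ∈ X, ∀ b ∈ X, a * b = b * a) (hsep : ∀ a ∈ X, IsSeparableElement K a) :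
    IsTorus K (Algebra.adjoin K X) := by
  have hc := Algebra.isMulCommutative_adjoin K hcomm
  have hmul : ∀ a b : Algebra.adjoin K X, a * b = b * a := hc.is_comm.comm
  let _ : CommRing (Algebra.adjoin K X) :=
    { (inferInstance : Ring (Algebra.adjoin K X)) with mul_comm := hmul }
  refine ⟨fun a ha b hb => congrArg Subtype.val (hmul ⟨a, ha⟩ ⟨b, hb⟩), fun a ha => ?_⟩
  have hu : Algebra.FormallyUnramified K (Algebra.adjoin K X) :=
    formallyUnramified_of_adjoin_eq_top (Algebra.adjoin_adjoin_coe_preimage (R := K) (s := X))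
      fun x hx => (isSeparableElement_map_iff (Algebra.adjoin K X).val
        Subtype.val_injective x).1 (hsep _ hx)
  exact (isSeparableElement_map_iff (Algebra.adjoin K X).val Subtype.val_injective ⟨a, ha⟩).2
    (isSeparableElement_of_formallyUnramified _)

/-- A torus centralises a representative of every residue class modulo an ideal with commutative
quotient. -/
theorem IsTorus.exists_commute_map_eq {K A B : Type u} [Field K] [Ring A] [Algebra K A]
    [FiniteDimensional K A] [CommRing B] [Algebra K B] (φ : A →ₐ[K] B) {T : Subalgebra K A}
    (hT : IsTorus K T) (a : A) : ∃ c : A, (∀ t ∈ T, t * c = c * t) ∧ φ c = φ a := by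
  let _ : CommRing T :=
    { (inferInstance : Ring T) with
      mul_comm := fun x y => Subtype.ext (hT.1 _ x.2 _ y.2) }
  have hu : Algebra.FormallyUnramified K T :=
    formallyUnramified_of_adjoin_eq_top (X := Set.univ) (Algebra.adjoin_univ K T) fun x _ =>
      (isSeparableElement_map_iff T.val Subtype.val_injective x).1 (hT.2 _ x.2)
  obtain ⟨e, he, he1⟩ := Algebra.FormallyUnramified.iff_exists_tensorProduct.1 hu
  let Φ : T ⊗[K] T →ₗ[K] A := TensorProduct.lift
    ((LinearMap.mul K A ∘ₗ LinearMap.mulRight K a ∘ₗ T.val.toLinearMap).compl₂ T.val.toLinearMap)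
  have hΦ (x y : T) : Φ (x ⊗ₜ y) = x * a * y := rfl
  have hl (s : T) (u : T ⊗[K] T) : Φ ((s ⊗ₜ 1) * u) = s * Φ u := by
    induction u with
    | zero => simp
    | add u v hu hv => rw [mul_add, map_add, map_add, mul_add, hu, hv]
    | tmul x y => rw [Algebra.TensorProduct.tmul_mul_tmul, hΦ, hΦ]; simp [mul_assoc]
  have hr (s : T) (u : T ⊗[K] T) : Φ ((1 ⊗ₜ s) * u) = Φ u * s := by
    induction u with
    | zero => simp
    | add u v hu hv => rw [mul_add, map_add, map_add, add_mul, hu, hv]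
    | tmul x y =>
      rw [Algebra.TensorProduct.tmul_mul_tmul, hΦ, hΦ, mul_comm s y]; simp [mul_assoc]
  have hφ (u : T ⊗[K] T) : φ (Φ u) = φ (Algebra.TensorProduct.lmul' K u : T) * φ a := by
    induction u with
    | zero => simp
    | add u v hu hv => simp only [map_add, hu, hv, Subalgebra.coe_add, add_mul]
    | tmul x y => rw [hΦ]; simp [mul_right_comm]
  refine ⟨Φ e, fun t ht => ?_, by rw [hφ, he1]; simp⟩
  have := congrArg Φ (he ⟨t, ht⟩)
  rw [sub_mul, map_sub, hl, hr, map_zero, sub_eq_zero] at this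
  exact this.symm

open Polynomial in
/-- An element annihilated by a separable polynomial up to nilpotents is, up to nilpotents,
a polynomial in itself annihilated by that polynomial. -/
theorem exists_mem_adjoin_isNilpotent_sub_aeval_eq_zero {K A : Type u} [Field K] [Ring A]
    [Algebra K A] {P : K[X]} (hP : P.Separable) {a : A} (ha : IsNilpotent (aeval a P)) :
    ∃ s ∈ Algebra.adjoin K {a}, IsNilpotent (a - s) ∧ aeval s P = 0 := by
  have hc := Algebra.isMulCommutative_adjoin K (s := {a}) (by simp)
  let _ : CommRing (Algebra.adjoin K {a}) :=
    { (inferInstance : Ring (Algebra.adjoin K {a})) with mul_comm := hc.is_comm.comm }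
  let x : Algebra.adjoin K {a} := ⟨a, Algebra.self_mem_adjoin_singleton K a⟩
  have hval (y : Algebra.adjoin K {a}) (p : K[X]) :
      ((aeval y p : Algebra.adjoin K {a}) : A) = aeval (y : A) p :=
    (aeval_algHom_apply (Algebra.adjoin K {a}).val y p).symm
  have hx : IsNilpotent (aeval x P) := by
    obtain ⟨n, hn⟩ := ha
    exact ⟨n, Subtype.ext (by rw [SubmonoidClass.coe_pow, hval]; exact hn)⟩
  have hx' : IsUnit (aeval x (derivative P)) := by
    obtain ⟨u, v, huv⟩ := hP
    have h2 := congrArg (aeval x) huv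
    simp only [map_add, map_mul, map_one] at h2
    refine isUnit_of_mul_isUnit_right (x := aeval x v) ?_
    rw [← eq_sub_iff_add_eq'] at h2
    rw [h2]
    exact ((Commute.all _ _).isNilpotent_mul_left hx).isUnit_one_sub
  obtain ⟨r, ⟨⟨n, hn⟩, hr⟩, -⟩ := existsUnique_nilpotent_sub_and_aeval_eq_zero hx hx'
  refine ⟨r, r.2, ⟨n, ?_⟩, ?_⟩
  · simpa using congrArg Subtype.val hn
  · rw [← hval, hr]; rfl

theorem isNilpotent_of_mem_jacobsonRadical {A : Type u} [Ring A] [IsArtinianRing A] {a : A}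
    (ha : a ∈ jacobsonRadical A) : IsNilpotent a := by
  obtain ⟨n, hn⟩ := IsArtinianRing.isNilpotent_jacobson_bot (R := A)
  have h := Ideal.pow_mem_pow ha n
  rw [jacobsonRadical, hn] at h
  exact ⟨n, h⟩

section Quotient

variable {K A B : Type u} [Field K] [Ring A] [Algebra K A] [FiniteDimensional K A]
  [CommRing B] [Algebra K B] [IsReduced (AlgebraicClosure K ⊗[K] B)] {φ : A →ₐ[K] B}

theorem IsTorus.disjoint_jacobsonRadical {T : Subalgebra K A} (hT : IsTorus K T) :
    Disjoint (Subalgebra.toSubmodule T) ((jacobsonRadical A).restrictScalars K) := by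
  have := IsArtinianRing.of_finite K A
  rw [Submodule.disjoint_def]
  exact fun x hx hxr => (hT.2 x hx).eq_zero_of_isNilpotent (isNilpotent_of_mem_jacobsonRadical hxr)

theorem IsRadicalComplement.isTorus (hker : ∀ x : A, φ x = 0 ↔ x ∈ jacobsonRadical A)
    {T : Subalgebra K A} (hT : IsRadicalComplement K T) : IsTorus K T := by
  have hinj : ∀ x ∈ T, φ x = 0 → x = 0 := fun x hx h0 =>
    Submodule.disjoint_def.1 hT.disjoint x hx ((hker x).1 h0)
  refine ⟨fun a ha b hb => sub_eq_zero.1 (hinj _ (sub_mem (mul_mem ha hb) (mul_mem hb ha)) ?_),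
    fun a ha => ?_⟩
  · rw [map_sub, map_mul, map_mul, mul_comm, sub_self]
  · have hi : Function.Injective (φ.comp T.val) :=
      (injective_iff_map_eq_zero _).2 fun x hx => Subtype.ext (hinj _ x.2 hx)
    have := (isSeparableElement_map_iff (φ.comp T.val) hi ⟨a, ha⟩).1
      (isSeparableElement_of_isReduced_tensorProduct
        ((Algebra.IsIntegral.isIntegral (R := K) a).map φ))
    exact (isSeparableElement_map_iff T.val Subtype.val_injective ⟨a, ha⟩).2 this

theorem IsRadicalComplement.isMaximalTorus (hker : ∀ x : A, φ x = 0 ↔ x ∈ jacobsonRadical A)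
    {T : Subalgebra K A} (hT : IsRadicalComplement K T) : IsMaximalTorus K T := by
  refine ⟨hT.isTorus hker, fun S hS hTS => le_antisymm hTS fun s hs => ?_⟩
  obtain ⟨t, ht, r, hr, rfl⟩ := Submodule.mem_sup.1
    (hT.codisjoint.eq_top ▸ Submodule.mem_top :
      s ∈ Subalgebra.toSubmodule T ⊔ (jacobsonRadical A).restrictScalars K)
  have hrS : r ∈ S := by simpa using sub_mem hs (hTS ht)
  rw [Submodule.disjoint_def.1 hS.disjoint_jacobsonRadical r hrS hr, add_zero]
  exact ht

theorem IsMaximalTorus.isRadicalComplement (hker : ∀ x : A, φ x = 0 ↔ x ∈ jacobsonRadical A)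
    {T : Subalgebra K A} (hT : IsMaximalTorus K T) : IsRadicalComplement K T := by
  have := IsArtinianRing.of_finite K A
  have hB : IsReduced B := isReduced_of_injective
    (Algebra.TensorProduct.includeRight : B →ₐ[K] AlgebraicClosure K ⊗[K] B)
    (Algebra.TensorProduct.includeRight_injective (RingHom.injective _))
  refine ⟨hT.1.disjoint_jacobsonRadical, codisjoint_iff.2 (eq_top_iff.2 fun a _ => ?_)⟩
  obtain ⟨c, hc, hca⟩ := hT.1.exists_commute_map_eq φ a
  have hsep : IsSeparableElement K (φ c) := isSeparableElement_of_isReduced_tensorProduct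
    ((Algebra.IsIntegral.isIntegral (R := K) c).map φ)
  have hnil : IsNilpotent (Polynomial.aeval c (minpoly K (φ c))) := by
    refine isNilpotent_of_mem_jacobsonRadical ((hker _).1 ?_)
    rw [← Polynomial.aeval_algHom_apply, minpoly.aeval]
  obtain ⟨s, hs, hcs, hs0⟩ := exists_mem_adjoin_isNilpotent_sub_aeval_eq_zero hsep.2 hnil
  have hs_sep : IsSeparableElement K s :=
    ⟨Algebra.IsIntegral.isIntegral s, hsep.2.of_dvd (minpoly.dvd K s hs0)⟩
  have hs_comm : ∀ t ∈ T, t * s = s * t := by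
    intro t ht
    have : Algebra.adjoin K {c} ≤ Subalgebra.centralizer K {t} := by
      rw [Algebra.adjoin_le_iff, Set.singleton_subset_iff]
      exact Subalgebra.mem_centralizer_iff K |>.2 (by simpa using hc t ht)
    exact (Subalgebra.mem_centralizer_iff K).1 (this hs) t rfl
  have hTs : IsTorus K (Algebra.adjoin K (insert s (T : Set A))) := by
    refine isTorus_adjoin ?_ ?_
    · rintro x (rfl | hx) y (rfl | hy)
      · rfl
      · exact (hs_comm y hy).symm
      · exact hs_comm x hx
      · exact hT.1.1 x hx y hy
    · rintro x (rfl | hx)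
      · exact hs_sep
      · exact hT.1.2 x hx
  have hsT : s ∈ T := by
    rw [hT.2 _ hTs fun t ht => Algebra.subset_adjoin (Set.mem_insert_of_mem s ht)]
    exact Algebra.subset_adjoin (Set.mem_insert s _)
  refine Submodule.mem_sup.2 ⟨s, hsT, a - s, (hker _).1 ?_, add_sub_cancel s a⟩
  rw [map_sub, ← hca, ← map_sub]
  exact (hcs.map φ).eq_zero

end Quotient

/-- Let `A` be a finite-dimensional associative unital soluble `K`-algebra with separable
radical factor algebra. A subalgebra `T` of `A` is a maximal torus of `A` if and only if `T` is
a radical complement of `A`. -/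
theorem isMaximalTorus_iff_isRadicalComplement
    (K A : Type u) [Field K] [Ring A] [Algebra K A] [FiniteDimensional K A]
    (hsol : IsSolubleAlgebra A) (hsep : HasSeparableRadicalFactor K A)
    (T : Subalgebra K A) :
    IsMaximalTorus K T ↔ IsRadicalComplement K T := by
  obtain ⟨B, _, _, φ, hsurj, hker, hss⟩ := hsep
  have hcomm : ∀ x y : B, x * y = y * x := by
    intro x y
    obtain ⟨a, rfl⟩ := hsurj x
    obtain ⟨b, rfl⟩ := hsurj y
    rw [← sub_eq_zero, ← map_mul, ← map_mul, ← map_sub]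
    exact (hker _).2 (hsol a b)
  let _ : CommRing B := { ‹Ring B› with mul_comm := hcomm }
  have hF : IsSemisimpleRing (AlgebraicClosure K ⊗[K] B) := hss _ _ _
  have : IsReduced (AlgebraicClosure K ⊗[K] B) := inferInstance
  exact ⟨fun h => h.isRadicalComplement hker, fun h => h.isMaximalTorus hker⟩
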